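/- Let (H, d_H, ι_H) be the data of Example I or Example II, let H ∈ C⁰(X,H) be arbitrary and set f = Φ(H). Then for any x ∈ X, any w₀, w₁ ∈ 𝕋 with w₀ ≠ w₁, and any ε > 0, there exists a pair (p₀, p₁) with d_H(p₀, H(x)) < ε and d_H(p₁, H(g(x))) < ε such that ι_H(p₁)∘ι_H(p₀)(w₀) = (f²)_x(w₀) while ι_H(p₁)∘ι_H(p₀)(w₁) ≠ (f²)_x(w₁). -/

import Mathlib

open Filter Topology MeasureTheory

namespace ForcedCircle

variable {X : Type*}

/-- Forward fiberwise iteration: `(F^n)_x = F_{g^{n-1} x} ∘ ⋯ ∘ F_x`. -/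
def fiberIter (g : X → X) (F : X → ℝ → ℝ) : ℕ → X → ℝ → ℝ
  | 0, _, y => y
  | n + 1, x, y => F (g^[n] x) (fiberIter g F n x y)

/-- Lift data of a `g`-forced circle homeomorphism: a fiberwise increasing
homeomorphism of `ℝ` commuting with `y ↦ y + 1`, jointly continuous. -/
structure ForcedLift [TopologicalSpace X] (g : X → X) where
  F : X → ℝ → ℝ
  cont : Continuous fun p : X × ℝ => F p.1 p.2
  mono : ∀ x, StrictMono (F x)
  surj : ∀ x, Function.Surjective (F x)
  periodic : ∀ x y, F x (y + 1) = F x y + 1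

/-- `Diff^{0,1}_g(X×𝕋)`: fibers are orientation-preserving `C¹` circle
diffeomorphisms depending continuously (in the `C¹` topology) on the base point. -/
structure ForcedC1 [TopologicalSpace X] (g : X → X) extends ForcedLift g where
  fiber_c1 : ∀ x, ContDiff ℝ 1 (F x)
  deriv_pos : ∀ x y, 0 < deriv (F x) y
  deriv_cont : Continuous fun p : X × ℝ => deriv (F p.1) p.2

/-- `ρ` is the fibered rotation number of the lifted forced system `F`. -/
def HasRotNum (g : X → X) (F : X → ℝ → ℝ) (ρ : ℝ) : Prop :=
  ∀ x y, Tendsto (fun n : ℕ => (fiberIter g F n x y - y) / n) atTop (nhds ρ)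

/-- The circle projections of the forced systems lifted by `F` and `F'` are
pointwise within `δ`. -/
def CircleClose (F F' : X → ℝ → ℝ) (δ : ℝ) : Prop :=
  ∀ x y, ∃ m : ℤ, |F' x y - F x y - (m : ℝ)| < δ

/-- Mode-locking: the rotation number (mod `1`) is constant on a `C⁰`
neighbourhood of the forced circle homeomorphism lifted by `F`. -/
def ModeLocked [TopologicalSpace X] (g : X → X) (F : X → ℝ → ℝ) : Prop :=
  ∃ δ : ℝ, 0 < δ ∧ ∀ F' : ForcedLift g, CircleClose F F'.F δ →
    ∀ ρ ρ' : ℝ, HasRotNum g F ρ → HasRotNum g F'.F ρ' → ∃ m : ℤ, ρ' = ρ + (m : ℝ)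

/-- `g` admits exactly one invariant Borel probability measure. -/
def UniquelyErgodic [MeasurableSpace X] (g : X → X) : Prop :=
  ∃! μ : ProbabilityMeasure X, Measure.map g (μ : Measure X) = (μ : Measure X)

def Minimal [TopologicalSpace X] (g : X → X) : Prop :=
  ∀ x, Dense (Set.range fun n : ℕ => g^[n] x)

/-- `g` has a non-periodic factor of finite dimension: an infinite compact
subset of some Euclidean space carrying a homeomorphic factor of `g`. -/
def HasFinDimNonperiodicFactor [TopologicalSpace X] (g : X → X) : Prop :=
  ∃ (d : ℕ) (Y : Set (Fin d → ℝ)) (gbar : Y ≃ₜ Y) (h : X → Y),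
    Y.Infinite ∧ IsCompact Y ∧ Continuous h ∧ Function.Surjective h ∧
      ∀ x, h (g x) = gbar (h x)

/-- The range of the Schwartzman asymptotic cycle of `g` (w.r.t. the invariant
measure `ν`). -/
def SchwartzmanGroup [TopologicalSpace X] [MeasurableSpace X] (g : X → X)
    (ν : Measure X) : Set ℝ :=
  {t | ∃ (φ : X → ℝ) (ψ : X → AddCircle (1 : ℝ)), Continuous φ ∧ Continuous ψ ∧
    t = ∫ x, φ x ∂ν ∧ ∀ x, ψ (g x) - ψ x = ((φ x : ℝ) : AddCircle (1 : ℝ))}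

/-- A lift of an orientation-preserving `C^r` circle diffeomorphism. -/
def IsCrLift (r : ℕ∞) (f : ℝ → ℝ) : Prop :=
  ContDiff ℝ r f ∧ (∀ y, 0 < deriv f y) ∧ ∀ y, f (y + 1) = f y + 1

/-- Abstract data `(ℋ, d_ℋ, ι_ℋ)`: a space with a distance and a map into
(lifts of) `C¹` circle diffeomorphisms. -/
structure HData where
  H : Type
  dist : H → H → ℝ
  iota : H → ℝ → ℝ
  iota_lift : ∀ h, IsCrLift 1 (iota h)

noncomputable def crDist (r : ℕ) (f g : ℝ → ℝ) : ℝ :=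
  ∑ k ∈ Finset.range (r + 1), ⨆ y : ℝ, |iteratedDeriv k f y - iteratedDeriv k g y|

noncomputable def liftDist (r : ℕ) (f g : ℝ → ℝ) : ℝ :=
  crDist r f g + crDist r (Function.invFun f) (Function.invFun g)

noncomputable def liftDistInf (f g : ℝ → ℝ) : ℝ :=
  ∑' k : ℕ, (2 : ℝ)⁻¹ ^ (k + 1) * (liftDist (k + 1) f g / (liftDist (k + 1) f g + 1))

/-- Example I: `ℋ = widetilde{Diff}^r(𝕋)` with the `C^r` metric (including inverses). -/
def HData.IsExampleI (hd : HData) : Prop :=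
  ∃ r : ℕ∞, 1 ≤ r ∧ ∃ e : hd.H ≃ {f : ℝ → ℝ // IsCrLift r f},
    (∀ h, hd.iota h = (e h).1) ∧
    (∀ n : ℕ, r = (n : ℕ∞) → ∀ h h', hd.dist h h' = liftDist n (e h).1 (e h').1) ∧
    (r = ⊤ → ∀ h h', hd.dist h h' = liftDistInf (e h).1 (e h').1)

/-- `P` is (the lift of) a non-constant real-analytic function on `𝕋` with
`‖P'‖ < 1`. -/
def GoodP (P : ℝ → ℝ) : Prop :=
  AnalyticOnNhd ℝ P Set.univ ∧ (∀ y, P (y + 1) = P y) ∧ (∃ a b, P a ≠ P b) ∧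
    ∀ y, |deriv P y| < 1

/-- `P` has no smaller period. -/
def NoSmallerPeriod (P : ℝ → ℝ) : Prop :=
  ¬ ∃ ρ ∈ Set.Ioo (0 : ℝ) 1, ∀ w, P (w + ρ) = P w

/-- Example III with explicit witnesses: `ℋ = ℝ`, `ι_ℋ(h)(w) = w + P(w) + h`. -/
def HData.IsExampleIIIWith (hd : HData) (P : ℝ → ℝ) (e : hd.H ≃ ℝ) : Prop :=
  GoodP P ∧ (∀ h h', hd.dist h h' = |e h - e h'|) ∧ ∀ h y, hd.iota h y = y + P y + e h

def HData.IsExampleIII (hd : HData) : Prop := ∃ P e, hd.IsExampleIIIWith P e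

/-- Example II: Example III where moreover `P` has no smaller period. -/
def HData.IsExampleIIWith (hd : HData) (P : ℝ → ℝ) (e : hd.H ≃ ℝ) : Prop :=
  hd.IsExampleIIIWith P e ∧ NoSmallerPeriod P

def HData.IsExampleII (hd : HData) : Prop := ∃ P e, hd.IsExampleIIWith P e

/-- Continuity of `H : X → ℋ` with respect to `d_ℋ`. -/
def ContH [TopologicalSpace X] (hd : HData) (H : X → hd.H) : Prop :=
  ∀ (x : X) (ε : ℝ), 0 < ε → ∃ U ∈ nhds x, ∀ x' ∈ U, hd.dist (H x) (H x') < ε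

/-- The metric `D_ℋ` on `C⁰(X, ℋ)`. -/
noncomputable def DH (hd : HData) (H H' : X → hd.H) : ℝ :=
  ⨆ x : X, hd.dist (H x) (H' x)

/-- The lift of `Φ(H)`. -/
def Phi (hd : HData) (H : X → hd.H) : X → ℝ → ℝ := fun x => hd.iota (H x)

/-- `S` is open in `(C⁰(X,ℋ), D_ℋ)`. -/
def OpenInC0 [TopologicalSpace X] (hd : HData) (S : Set (X → hd.H)) : Prop :=
  ∀ H, ContH hd H → H ∈ S → ∃ ε : ℝ, 0 < ε ∧
    ∀ H', ContH hd H' → DH hd H H' < ε → H' ∈ S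

/-- `S` is dense in `(C⁰(X,ℋ), D_ℋ)`. -/
def DenseInC0 [TopologicalSpace X] (hd : HData) (S : Set (X → hd.H)) : Prop :=
  ∀ H, ContH hd H → ∀ ε : ℝ, 0 < ε → ∃ H', ContH hd H' ∧ DH hd H H' < ε ∧ H' ∈ S

/-- `H` lies in the closure of `𝓜𝓛(ℋ)` inside `(C⁰(X,ℋ), D_ℋ)`. -/
def InClosureML [TopologicalSpace X] (hd : HData) (g : X → X) (H : X → hd.H) : Prop :=
  ∀ ε : ℝ, 0 < ε → ∃ H', ContH hd H' ∧ DH hd H H' < ε ∧ ModeLocked g (Phi hd H')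

/-- The complement of the closure of `𝓜𝓛(ℋ)` in `C⁰(X,ℋ)`. -/
def C0NotClosML [TopologicalSpace X] (hd : HData) (g : X → X) : Set (X → hd.H) :=
  {H | ContH hd H ∧ ¬ InClosureML hd g H}

/-- Relative openness in `C⁰(X,ℋ) \ closure(𝓜𝓛(ℋ))`. -/
def OpenInCompl [TopologicalSpace X] (hd : HData) (g : X → X) (S : Set (X → hd.H)) : Prop :=
  ∀ H ∈ S ∩ C0NotClosML hd g, ∃ ε : ℝ, 0 < ε ∧
    ∀ H' ∈ C0NotClosML hd g, DH hd H H' < ε → H' ∈ S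

/-- Relative density in `C⁰(X,ℋ) \ closure(𝓜𝓛(ℋ))`. -/
def DenseInCompl [TopologicalSpace X] (hd : HData) (g : X → X) (S : Set (X → hd.H)) : Prop :=
  ∀ H ∈ C0NotClosML hd g, ∀ ε : ℝ, 0 < ε → ∃ H' ∈ C0NotClosML hd g ∩ S, DH hd H H' < ε

/-- `L` is the upper extremal fiberwise Lyapunov exponent `L₊`. -/
def HasLplus (g : X → X) (F : X → ℝ → ℝ) (L : ℝ) : Prop :=
  Tendsto (fun n : ℕ => (⨆ p : X × ℝ, Real.log (deriv (fiberIter g F n p.1) p.2)) / n)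
    atTop (nhds L)

/-- `L` is the lower extremal fiberwise Lyapunov exponent `L₋`. -/
def HasLminus (g : X → X) (F : X → ℝ → ℝ) (L : ℝ) : Prop :=
  Tendsto (fun n : ℕ => (⨅ p : X × ℝ, Real.log (deriv (fiberIter g F n p.1) p.2)) / n)
    atTop (nhds L)

/-- `‖f‖_{C^{0,1}} = sup_x max(‖Df_x‖, ‖D(f_x⁻¹)‖)`. -/
noncomputable def Cnorm (F : X → ℝ → ℝ) : ℝ :=
  ⨆ p : X × ℝ, max (deriv (F p.1) p.2) (deriv (F p.1) p.2)⁻¹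

/-- Composition of a list of maps, first element applied first. -/
def compList : List (ℝ → ℝ) → ℝ → ℝ
  | [], y => y
  | f :: l, y => compList l (f y)

/-- `ι_ℋ(h_{n-1}) ∘ ⋯ ∘ ι_ℋ(h_0)`. -/
noncomputable def tupleComp (hd : HData) {n : ℕ} (p : Fin n → hd.H) : ℝ → ℝ :=
  compList (List.ofFn fun i => hd.iota (p i))

/-- `𝐋₊` of a tuple. -/
noncomputable def bLplus (hd : HData) {n : ℕ} (p : Fin n → hd.H) : ℝ :=
  (⨆ y : ℝ, Real.log (deriv (tupleComp hd p) y)) / n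

/-- `𝐋₋` of a tuple. -/
noncomputable def bLminus (hd : HData) {n : ℕ} (p : Fin n → hd.H) : ℝ :=
  (⨅ y : ℝ, Real.log (deriv (tupleComp hd p) y)) / n

/-- The quantitative contractability condition of Example II, w.r.t. `P`. -/
def ContractableWith (g : X → X) (P : ℝ → ℝ) (F : X → ℝ → ℝ) : Prop :=
  ∃ k : ℕ, 1 < k ∧ ∀ (x : X) (w : ℝ), ∃ i : ℕ, i ≤ k - 2 ∧
    deriv (deriv P) (fiberIter g F (i + 1) x w) ≠ 0

/-- `H ∈ C⁰(X,ℋ)` is contractable. -/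
def Contractable [TopologicalSpace X] (hd : HData) (g : X → X) (H : X → hd.H) : Prop :=
  hd.IsExampleI ∨ ∃ P e, hd.IsExampleIIWith P e ∧ ContractableWith g P (Phi hd H)

/-- `F` is a lift of `Φ(H)`. -/
def IsLiftOfPhi [TopologicalSpace X] (hd : HData) (H : X → hd.H) (F : X → ℝ → ℝ) : Prop :=
  ∃ m : X → ℤ, Continuous (fun x => (m x : ℝ)) ∧ ∀ x y, F x y = hd.iota (H x) y + (m x : ℝ)

/-- `M̲(F,n)`. -/
noncomputable def Mlow (g : X → X) (F : X → ℝ → ℝ) (n : ℕ) : ℝ :=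
  ⨅ p : X × ℝ, (fiberIter g F n p.1 p.2 - p.2)

/-- `M̄(F,n)`. -/
noncomputable def Mup (g : X → X) (F : X → ℝ → ℝ) (n : ℕ) : ℝ :=
  ⨆ p : X × ℝ, (fiberIter g F n p.1 p.2 - p.2)

end ForcedCircle
namespace ForcedCircle

/-! ### Perturbations in Example II -/

/-- A real-analytic `1`-periodic function without smaller period cannot have a locally constant
difference `P (a + t) - P (b + t)` unless `a - b` is an integer. -/
lemma exists_sub_ne_of_noSmallerPeriod {P : ℝ → ℝ} (hP : GoodP P) (hN : NoSmallerPeriod P)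
    {a b : ℝ} (hab : ∀ m : ℤ, a - b ≠ m) :
    ∃ᶠ t in 𝓝 (0 : ℝ), P (a + t) - P (b + t) ≠ P a - P b := by
  obtain ⟨han, hper, -, -⟩ := hP
  intro hev
  simp only [ne_eq, not_not] at hev
  have hshift : ∀ c : ℝ, AnalyticOnNhd ℝ (fun t => P (c + t)) Set.univ := fun c t _ =>
    (han (c + t) trivial).comp (analyticAt_const.add analyticAt_id)
  have heq : (fun t => P (a + t) - P (b + t)) = fun _ => P a - P b :=
    ((hshift a).sub (hshift b)).eq_of_eventuallyEq (z₀ := 0) analyticOnNhd_const hev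
  have hP' : Function.Periodic P 1 := hper
  set c := P a - P b with hc
  have hstep : ∀ w, P (w + (a - b)) = P w + c := fun w => by
    have h : P (a + (w - b)) - P (b + (w - b)) = c := congrFun heq (w - b)
    rw [show a + (w - b) = w + (a - b) by ring, show b + (w - b) = w by ring] at h
    linarith
  have hiter : ∀ n : ℕ, P (n * (a - b)) = P 0 + n * c := by
    intro n
    induction n with
    | zero => simp
    | succ k ih =>
      rw [show ((k + 1 : ℕ) : ℝ) * (a - b) = k * (a - b) + (a - b) by push_cast; ring, hstep, ih]
      push_cast; ring
  obtain ⟨M, hM⟩ : ∃ M, ∀ w, |P w| ≤ M := by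
    obtain ⟨M, hM⟩ := isCompact_Icc.exists_bound_of_continuousOn (s := Set.Icc (0 : ℝ) 1)
      (han.continuousOn.mono (Set.subset_univ _))
    refine ⟨M, fun w => ?_⟩
    obtain ⟨y, hy, hwy⟩ := hP'.exists_mem_Ico₀ one_pos w
    rw [hwy]
    exact hM y ⟨hy.1, hy.2.le⟩
  have hc0 : c = 0 := by
    by_contra hne
    obtain ⟨n, hn⟩ := exists_nat_gt (2 * M / |c|)
    rw [div_lt_iff₀ (abs_pos.2 hne)] at hn
    have h1 : |(n : ℝ) * c| = n * |c| := by rw [abs_mul, Nat.abs_cast]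
    have h2 : (n : ℝ) * c = P (n * (a - b)) - P 0 := by rw [hiter]; ring
    have h3 := abs_sub (P (n * (a - b))) (P 0)
    rw [← h2, h1] at h3
    linarith [hM (n * (a - b)), hM 0]
  refine hN ⟨Int.fract (a - b), ⟨?_, Int.fract_lt_one _⟩, fun w => ?_⟩
  · refine (Int.fract_nonneg _).lt_of_ne fun h => hab ⌊a - b⌋ ?_
    have := Int.floor_add_fract (a - b)
    linarith
  · have h := hP'.sub_int_mul_eq (x := w + (a - b)) ⌊a - b⌋
    rw [hstep, hc0, add_zero] at h
    rw [← h]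
    congr 1
    rw [Int.fract]; ring

/-! ### Lifts of circle diffeomorphisms -/

lemma IsCrLift.strictMono {r : ℕ∞} {f : ℝ → ℝ} (hf : IsCrLift r f) : StrictMono f :=
  strictMono_of_deriv_pos hf.2.1

/-- A lift of a circle diffeomorphism, as a monotone map of degree one. -/
def IsCrLift.toCircleDeg1Lift {r : ℕ∞} {f : ℝ → ℝ} (hf : IsCrLift r f) : CircleDeg1Lift :=
  ⟨⟨f, hf.strictMono.monotone⟩, hf.2.2⟩

lemma IsCrLift.surjective {r : ℕ∞} {f : ℝ → ℝ} (hf : IsCrLift r f) : Function.Surjective f :=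
  hf.1.continuous.surjective hf.toCircleDeg1Lift.tendsto_atTop hf.toCircleDeg1Lift.tendsto_atBot

lemma IsCrLift.sub_ne_int {r : ℕ∞} {f : ℝ → ℝ} (hf : IsCrLift r f) {a b : ℝ}
    (hab : ∀ m : ℤ, a - b ≠ m) (m : ℤ) : f a - f b ≠ m := fun h => by
  have h1 : f (b + m) = f b + m := hf.toCircleDeg1Lift.map_add_int b m
  have h2 : f a = f (b + m) := by linarith
  exact hab m (by rw [hf.strictMono.injective h2]; ring)

lemma rightInverse_invFun_of_isCrLift {r : ℕ∞} {f : ℝ → ℝ} (hf : IsCrLift r f) :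
    Function.RightInverse (Function.invFun f) f :=
  Function.rightInverse_invFun hf.surjective

lemma IsCrLift.invFun_add_one {r : ℕ∞} {f : ℝ → ℝ} (hf : IsCrLift r f) (y : ℝ) :
    Function.invFun f (y + 1) = Function.invFun f y + 1 := by
  apply hf.strictMono.injective
  rw [hf.2.2, rightInverse_invFun_of_isCrLift hf, rightInverse_invFun_of_isCrLift hf]

/-! ### Families of functions depending smoothly on a parameter -/

lemma continuous_iteratedDeriv_snd (k : ℕ) {u : ℝ → ℝ → ℝ}
    (hu : ContDiff ℝ k fun p : ℝ × ℝ => u p.1 p.2) :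
    Continuous fun p : ℝ × ℝ => iteratedDeriv k (u p.1) p.2 := by
  induction k generalizing u with
  | zero => simpa using hu.continuous
  | succ k ih =>
    simp only [iteratedDeriv_succ']
    refine ih (u := fun s => deriv (u s)) ?_
    have hfd : ContDiff ℝ k fun p : ℝ × ℝ =>
        fderiv ℝ (fun p : ℝ × ℝ => u p.1 p.2) p (0, 1) :=
      (hu.fderiv_right (m := k) (by push_cast; exact le_rfl)).clm_apply contDiff_const
    convert hfd using 2 with p
    have h1 : HasFDerivAt (fun p : ℝ × ℝ => u p.1 p.2)
        (fderiv ℝ (fun p : ℝ × ℝ => u p.1 p.2) (p.1, p.2)) (p.1, p.2) :=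
      (hu.differentiable (by simp) _).hasFDerivAt
    exact (h1.comp_hasDerivAt p.2 ((hasDerivAt_const p.2 p.1).prodMk (hasDerivAt_id p.2))).deriv

lemma periodic_iteratedDeriv {f : ℝ → ℝ} {c : ℝ} (hf : Function.Periodic f c) (k : ℕ) :
    Function.Periodic (iteratedDeriv k f) c := fun y => by
  have h := congrFun (iteratedDeriv_comp_add_const k f c) y
  rw [← h, show (fun z => f (z + c)) = f from funext hf]

/-- If `u s y` is jointly `C^k` and `u s - u 0` is `1`-periodic, then `u s → u 0` uniformly
together with the `k`-th derivative in `y`. -/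
lemma tendsto_iSup_abs_iteratedDeriv_sub {k : ℕ} {u : ℝ → ℝ → ℝ}
    (hu : ContDiff ℝ k fun p : ℝ × ℝ => u p.1 p.2)
    (hper : ∀ s y, u s (y + 1) = u s y + 1) :
    Tendsto (fun s => ⨆ y : ℝ, |iteratedDeriv k (u s) y - iteratedDeriv k (u 0) y|)
      (𝓝 0) (𝓝 0) := by
  have hcd : ∀ s, ContDiff ℝ k (u s) := fun s => hu.comp (contDiff_const.prodMk contDiff_id)
  have hsub : ∀ s y, iteratedDeriv k (u s - u 0) y
      = iteratedDeriv k (u s) y - iteratedDeriv k (u 0) y := fun s y =>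
    iteratedDeriv_sub (hcd s).contDiffAt (hcd 0).contDiffAt
  have hpk : ∀ s, Function.Periodic (iteratedDeriv k (u s - u 0)) 1 := fun s =>
    periodic_iteratedDeriv (fun y => by simp [hper]) k
  have hcont : Continuous fun p : ℝ × ℝ => |iteratedDeriv k (u p.1 - u 0) p.2| := by
    simp only [hsub]
    have h := continuous_iteratedDeriv_snd k hu
    exact (h.sub (h.comp (continuous_const.prodMk continuous_snd))).abs
  simp only [← hsub]
  rw [Metric.tendsto_nhds]
  intro ε hε
  have hloc : ∀ᶠ s in 𝓝 (0 : ℝ), ∀ y ∈ Set.Icc (0 : ℝ) 1,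
      |iteratedDeriv k (u s - u 0) y| < ε / 2 := by
    refine isCompact_Icc.eventually_forall_of_forall_eventually fun y _ => ?_
    refine hcont.continuousAt.eventually_lt continuousAt_const ?_
    simpa [hsub] using hε
  filter_upwards [hloc] with s hs
  have hle : (⨆ y : ℝ, |iteratedDeriv k (u s - u 0) y|) ≤ ε / 2 := by
    refine ciSup_le fun y => ?_
    obtain ⟨z, hz, hyz⟩ := (hpk s).exists_mem_Ico₀ one_pos y
    rw [hyz]
    exact (hs z ⟨hz.1, hz.2.le⟩).le
  rw [Real.dist_0_eq_abs, abs_of_nonneg (Real.iSup_nonneg fun y => abs_nonneg _)]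
  linarith

lemma tendsto_crDist {n : ℕ} {u : ℝ → ℝ → ℝ}
    (hu : ContDiff ℝ n fun p : ℝ × ℝ => u p.1 p.2)
    (hper : ∀ s y, u s (y + 1) = u s y + 1) :
    Tendsto (fun s => crDist n (u s) (u 0)) (𝓝 0) (𝓝 0) := by
  have h : Tendsto (fun s => crDist n (u s) (u 0)) (𝓝 0)
      (𝓝 (∑ k ∈ Finset.range (n + 1), (0 : ℝ))) :=
    tendsto_finsetSum _ fun k hk => tendsto_iSup_abs_iteratedDeriv_sub
      (hu.of_le (by exact_mod_cast Nat.lt_succ_iff.1 (Finset.mem_range.1 hk))) hper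
  simpa using h

lemma crDist_nonneg (n : ℕ) (f g : ℝ → ℝ) : 0 ≤ crDist n f g :=
  Finset.sum_nonneg fun _ _ => Real.iSup_nonneg fun _ => abs_nonneg _

lemma liftDist_nonneg (n : ℕ) (f g : ℝ → ℝ) : 0 ≤ liftDist n f g :=
  add_nonneg (crDist_nonneg _ _ _) (crDist_nonneg _ _ _)

lemma liftDist_self (n : ℕ) (f : ℝ → ℝ) : liftDist n f f = 0 := by
  simp [liftDist, crDist]

lemma liftDistInf_self (f : ℝ → ℝ) : liftDistInf f f = 0 := by
  simp [liftDistInf, liftDist_self]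

/-- The fiberwise inverse of a jointly `C^r` family of lifts is jointly `C^r`. -/
lemma contDiff_invFun_family {r : ℕ∞} (hr : 1 ≤ r) {u : ℝ → ℝ → ℝ}
    (hu : ContDiff ℝ r fun p : ℝ × ℝ => u p.1 p.2) (hlift : ∀ s, IsCrLift r (u s)) :
    ContDiff ℝ r fun p : ℝ × ℝ => Function.invFun (u p.1) p.2 := by
  have hr0 : (r : WithTop ℕ∞) ≠ 0 := by
    rintro h
    have : r = 0 := by exact_mod_cast h
    simp [this] at hr
  let E : ℝ × ℝ ≃ ℝ × ℝ :=
    { toFun := fun p => (p.1, u p.1 p.2)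
      invFun := fun p => (p.1, Function.invFun (u p.1) p.2)
      left_inv := fun p => Prod.ext rfl
        (Function.leftInverse_invFun (hlift p.1).strictMono.injective p.2)
      right_inv := fun p => Prod.ext rfl (rightInverse_invFun_of_isCrLift (hlift p.1) p.2) }
  have hE : ContDiff ℝ r E := contDiff_fst.prodMk hu
  have hder : ∀ p, ∃ L : (ℝ × ℝ) ≃L[ℝ] (ℝ × ℝ),
      HasFDerivAt E (L : (ℝ × ℝ) →L[ℝ] (ℝ × ℝ)) p := by
    intro p
    set A := fderiv ℝ (fun p : ℝ × ℝ => u p.1 p.2) p with hA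
    have h1 : HasFDerivAt (fun p : ℝ × ℝ => u p.1 p.2) A p :=
      (hu.differentiable hr0 _).hasFDerivAt
    have h2 : HasFDerivAt E ((ContinuousLinearMap.fst ℝ ℝ ℝ).prod A) p :=
      hasFDerivAt_fst.prodMk h1
    have hpos : 0 < A (0, 1) := by
      have h3 : HasFDerivAt (fun p : ℝ × ℝ => u p.1 p.2) A (p.1, p.2) := h1
      have h4 := h3.comp_hasDerivAt p.2
        ((hasDerivAt_const p.2 p.1).prodMk (hasDerivAt_id p.2))
      rw [← h4.deriv]
      exact (hlift p.1).2.1 p.2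
    have hinj : Function.Injective ((ContinuousLinearMap.fst ℝ ℝ ℝ).prod A) := by
      rw [injective_iff_map_eq_zero]
      rintro ⟨a, b⟩ hab
      obtain ⟨ha, hb⟩ := Prod.ext_iff.1 hab
      simp only [ContinuousLinearMap.prod_apply, ContinuousLinearMap.coe_fst', Prod.fst_zero,
        Prod.snd_zero] at ha hb
      subst ha
      rw [show ((0 : ℝ), b) = b • ((0 : ℝ), (1 : ℝ)) by simp, map_smul, smul_eq_mul,
        mul_eq_zero] at hb
      simp [hb.resolve_right hpos.ne']
    refine ⟨(LinearEquiv.ofInjectiveEndo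
      (((ContinuousLinearMap.fst ℝ ℝ ℝ).prod A : (ℝ × ℝ) →L[ℝ] (ℝ × ℝ)) :
        (ℝ × ℝ) →ₗ[ℝ] (ℝ × ℝ)) hinj).toContinuousLinearEquiv, ?_⟩
    convert h2
    ext <;> rfl
  choose L hL using hder
  have hopen : IsOpenMap E := isOpenMap_of_hasStrictFDerivAt_equiv fun p =>
    hE.contDiffAt.hasStrictFDerivAt' (hL p) hr0
  let Φ : (ℝ × ℝ) ≃ₜ (ℝ × ℝ) := E.toHomeomorphOfContinuousOpen hE.continuous hopen
  exact contDiff_snd.comp (Φ.contDiff_symm (f₀' := L) hL hE)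

lemma tendsto_liftDist {r : ℕ∞} (hr : 1 ≤ r) {u : ℝ → ℝ → ℝ}
    (hu : ContDiff ℝ r fun p : ℝ × ℝ => u p.1 p.2) (hlift : ∀ s, IsCrLift r (u s))
    {n : ℕ} (hn : (n : ℕ∞) ≤ r) :
    Tendsto (fun s => liftDist n (u s) (u 0)) (𝓝 0) (𝓝 0) := by
  have hn' : (n : WithTop ℕ∞) ≤ r := by exact_mod_cast hn
  have h := (tendsto_crDist (hu.of_le hn') fun s => (hlift s).2.2).add
    (tendsto_crDist (u := fun s => Function.invFun (u s))
      ((contDiff_invFun_family hr hu hlift).of_le hn') fun s => (hlift s).invFun_add_one)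
  simpa [liftDist] using h

lemma tendsto_liftDistInf {u : ℝ → ℝ → ℝ}
    (h : ∀ n : ℕ, Tendsto (fun s => liftDist n (u s) (u 0)) (𝓝 0) (𝓝 0)) :
    Tendsto (fun s => liftDistInf (u s) (u 0)) (𝓝 0) (𝓝 0) := by
  have hsum : Summable fun k : ℕ => (2 : ℝ)⁻¹ ^ (k + 1) :=
    (summable_nat_add_iff 1).2 (summable_geometric_of_lt_one (by norm_num) (by norm_num))
  have hlim : Tendsto (fun s => liftDistInf (u s) (u 0)) (𝓝 0) (𝓝 (∑' _ : ℕ, (0 : ℝ))) := by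
    refine tendsto_tsum_of_dominated_convergence hsum (fun k => ?_)
      (Eventually.of_forall fun s k => ?_)
    · have hk := h (k + 1)
      have := (hk.div (hk.add_const 1) (by norm_num)).const_mul ((2 : ℝ)⁻¹ ^ (k + 1))
      simpa using this
    · have h0 := liftDist_nonneg (k + 1) (u s) (u 0)
      rw [norm_mul, Real.norm_of_nonneg (by positivity), Real.norm_of_nonneg (by positivity)]
      exact mul_le_of_le_one_right (by positivity) ((div_le_one (by positivity)).2 (by linarith))
  simpa using hlim

/-- Every lift `f` embeds in a jointly `C^r` family of lifts fixing the value at `a` and, for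
small nonzero parameters, moving the value at every `b ≠ a` of the circle. -/
lemma IsCrLift.exists_family {r : ℕ∞} (hr : 1 ≤ r) {f : ℝ → ℝ} (hf : IsCrLift r f) {a b : ℝ}
    (hab : ∀ m : ℤ, b - a ≠ m) :
    ∃ u : ℝ → ℝ → ℝ, ContDiff ℝ r (fun p : ℝ × ℝ => u p.1 p.2) ∧ (∀ s, IsCrLift r (u s)) ∧
      u 0 = f ∧ (∀ s, u s a = f a) ∧ ∀ᶠ s in 𝓝[≠] (0 : ℝ), ∀ m : ℤ, u s b ≠ f b + m := by
  obtain ⟨hcd, hpos, hper⟩ := id hf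
  have hr1 : (1 : WithTop ℕ∞) ≤ r := by exact_mod_cast hr
  have hdper : Function.Periodic (deriv f) 1 := fun y => by
    rw [← deriv_comp_add_const, show (fun z => f (z + 1)) = fun z => f z + 1 from funext hper,
      deriv_add_const]
  obtain ⟨c, hc, hcle⟩ : ∃ c > 0, ∀ y, c ≤ deriv f y := by
    obtain ⟨z, -, hz⟩ := isCompact_Icc.exists_isMinOn (s := Set.Icc (0 : ℝ) 1)
      (Set.nonempty_Icc.2 zero_le_one) (hcd.continuous_deriv hr1).continuousOn
    refine ⟨deriv f z, hpos z, fun y => ?_⟩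
    obtain ⟨w, hw, hyw⟩ := hdper.exists_mem_Ico₀ one_pos y
    rw [hyw]
    exact hz ⟨hw.1, hw.2.le⟩
  let β : ℝ → ℝ := fun y => 1 - Real.cos (2 * Real.pi * (y - a))
  have hβcd : ContDiff ℝ r β := by fun_prop
  have hβd : ∀ y, HasDerivAt β (2 * Real.pi * Real.sin (2 * Real.pi * (y - a))) y := fun y => by
    have h := ((((hasDerivAt_id y).sub_const a).const_mul (2 * Real.pi)).cos).const_sub 1
    exact h.congr_deriv (by simp only [id]; ring)
  have hβa : β a = 0 := by simp [β]
  have hβb : β b ≠ 0 := fun h => by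
    obtain ⟨m, hm⟩ := (Real.cos_eq_one_iff _).1 (sub_eq_zero.1 h).symm
    refine hab m (mul_right_cancel₀ (b := 2 * Real.pi) (by positivity) ?_)
    linarith
  have hβper : ∀ y, β (y + 1) = β y := fun y => by
    simp only [β]
    rw [show 2 * Real.pi * (y + 1 - a) = 2 * Real.pi * (y - a) + 2 * Real.pi by ring,
      Real.cos_add_two_pi]
  set δ := c / 14 with hδ
  have hδpos : 0 < δ := by positivity
  let u : ℝ → ℝ → ℝ := fun s y => f y + δ * Real.sin s * β y
  have hucd : ContDiff ℝ r fun p : ℝ × ℝ => u p.1 p.2 := by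
    have h1 : ContDiff ℝ r fun p : ℝ × ℝ => f p.2 := hcd.comp contDiff_snd
    have h2 : ContDiff ℝ r fun p : ℝ × ℝ => β p.2 := hβcd.comp contDiff_snd
    have h3 : ContDiff ℝ r fun p : ℝ × ℝ => Real.sin p.1 := Real.contDiff_sin.comp contDiff_fst
    exact h1.add ((contDiff_const.mul h3).mul h2)
  refine ⟨u, hucd, fun s => ⟨hucd.comp (contDiff_const.prodMk contDiff_id), fun y => ?_,
    fun y => ?_⟩, ?_, fun s => by simp [u, hβa], ?_⟩
  · have hfd : HasDerivAt f (deriv f y) y :=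
      (hcd.differentiable (fun h => by simp [h] at hr1) y).hasDerivAt
    have hd : HasDerivAt (u s) _ y := hfd.add ((hβd y).const_mul (δ * Real.sin s))
    rw [hd.deriv]
    have hbound : |δ * Real.sin s * (2 * Real.pi * Real.sin (2 * Real.pi * (y - a)))|
        ≤ δ * 1 * (7 * 1) := by
      rw [abs_mul, abs_mul, abs_mul, abs_of_pos hδpos, abs_of_pos Real.two_pi_pos]
      have := Real.pi_lt_d2
      gcongr
      · exact Real.abs_sin_le_one s
      · linarith
      · exact Real.abs_sin_le_one _
    have := (abs_le.1 hbound).1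
    have := hcle y
    linarith
  · simp only [u]
    rw [hper, hβper]; ring
  · funext y; simp [u]
  · have hlt : ∀ᶠ s in 𝓝 (0 : ℝ), |δ * Real.sin s * β b| < 1 := by
      refine ContinuousAt.eventually_lt (by fun_prop) continuousAt_const ?_
      simp
    have hIoo : ∀ᶠ s in 𝓝 (0 : ℝ), s ∈ Set.Ioo (-Real.pi) Real.pi :=
      Ioo_mem_nhds (by linarith [Real.pi_pos]) Real.pi_pos
    filter_upwards [nhdsWithin_le_nhds hlt, nhdsWithin_le_nhds hIoo, self_mem_nhdsWithin]
      with s hs hsI hs0 m hm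
    have hm' : δ * Real.sin s * β b = m := by
      simp only [u] at hm; linarith
    have hm0 : m = 0 := by
      rw [hm'] at hs
      exact Int.abs_lt_one_iff.1 (by exact_mod_cast hs)
    have hsin : Real.sin s ≠ 0 := fun h =>
      hs0 ((Real.sin_eq_zero_iff_of_lt_of_lt hsI.1 hsI.2).1 h)
    rw [hm0, Int.cast_zero] at hm'
    exact mul_ne_zero (mul_ne_zero hδpos.ne' hsin) hβb hm'

lemma exists_perturbation_of_isExampleI {hd : HData} (hex : hd.IsExampleI) (h₀ h₁ : hd.H)
    {w₀ w₁ : ℝ} (hw : ∀ m : ℤ, w₀ - w₁ ≠ m) {ε : ℝ} (hε : 0 < ε) :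
    ∃ p₀ p₁ : hd.H, hd.dist p₀ h₀ < ε ∧ hd.dist p₁ h₁ < ε ∧
      hd.iota p₁ (hd.iota p₀ w₀) = hd.iota h₁ (hd.iota h₀ w₀) ∧
      ∀ m : ℤ, hd.iota p₁ (hd.iota p₀ w₁) ≠ hd.iota h₁ (hd.iota h₀ w₁) + m := by
  obtain ⟨r, hr, e, hiota, hfin, hinf⟩ := hex
  have hw' : ∀ m : ℤ, hd.iota h₀ w₁ - hd.iota h₀ w₀ ≠ m := fun m h =>
    (hd.iota_lift h₀).sub_ne_int hw (-m) (by push_cast; linarith)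
  obtain ⟨u, hucd, hlift, hu0, hua, hub⟩ := (e h₁).2.exists_family hr hw'
  have hself : hd.dist h₀ h₀ = 0 := by
    induction r using ENat.recTopCoe with
    | top => rw [hinf rfl, liftDistInf_self]
    | coe n => rw [hfin n rfl, liftDist_self]
  have hdist : Tendsto (fun s => hd.dist (e.symm ⟨u s, hlift s⟩) h₁) (𝓝 0) (𝓝 0) := by
    induction r using ENat.recTopCoe with
    | top =>
      simp only [hinf rfl, Equiv.apply_symm_apply, ← hu0]
      exact tendsto_liftDistInf fun n => tendsto_liftDist hr hucd hlift le_top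
    | coe n =>
      simp only [hfin n rfl, Equiv.apply_symm_apply, ← hu0]
      exact tendsto_liftDist hr hucd hlift le_rfl
  obtain ⟨s, hs, hsb⟩ :=
    (((hdist.eventually_lt_const hε).filter_mono nhdsWithin_le_nhds).and hub).exists
  refine ⟨h₀, e.symm ⟨u s, hlift s⟩, by rwa [hself], hs, ?_, ?_⟩
  · rw [hiota (e.symm _), Equiv.apply_symm_apply, hiota h₁]
    exact hua s
  · rw [hiota (e.symm _), Equiv.apply_symm_apply, hiota h₁]
    exact hsb

lemma exists_perturbation_of_isExampleII {hd : HData} (hex : hd.IsExampleII) (h₀ h₁ : hd.H)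
    {w₀ w₁ : ℝ} (hw : ∀ m : ℤ, w₀ - w₁ ≠ m) {ε : ℝ} (hε : 0 < ε) :
    ∃ p₀ p₁ : hd.H, hd.dist p₀ h₀ < ε ∧ hd.dist p₁ h₁ < ε ∧
      hd.iota p₁ (hd.iota p₀ w₀) = hd.iota h₁ (hd.iota h₀ w₀) ∧
      ∀ m : ℤ, hd.iota p₁ (hd.iota p₀ w₁) ≠ hd.iota h₁ (hd.iota h₀ w₁) + m := by
  obtain ⟨P, e, ⟨hP, hdist, hiota⟩, hN⟩ := hex
  have hcont : Continuous P := continuousOn_univ.1 hP.1.continuousOn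
  set a := hd.iota h₀ w₀ with ha
  set b := hd.iota h₀ w₁ with hb
  have hfreq := exists_sub_ne_of_noSmallerPeriod hP hN ((hd.iota_lift h₀).sub_ne_int hw)
  have hsmall : ∀ᶠ t in 𝓝 (0 : ℝ), |t| < ε ∧ |P a - P (a + t) - t| < ε ∧
      |P (b + t) - P b + (P a - P (a + t))| < 1 := by
    refine (ContinuousAt.eventually_lt (by fun_prop) continuousAt_const (by simpa)).and
      ((ContinuousAt.eventually_lt (by fun_prop) continuousAt_const (by simpa)).and
        (ContinuousAt.eventually_lt (by fun_prop) continuousAt_const (by simp)))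
  obtain ⟨t, hne, ht, hs, hlt⟩ := (hfreq.and_eventually hsmall).exists
  have hp₀ : ∀ w, hd.iota (e.symm (e h₀ + t)) w = hd.iota h₀ w + t := fun w => by
    rw [hiota, hiota, Equiv.apply_symm_apply]; ring
  refine ⟨e.symm (e h₀ + t), e.symm (e h₁ + (P a - P (a + t) - t)), ?_, ?_, ?_, fun m hm => ?_⟩
  · rw [hdist, Equiv.apply_symm_apply]; simpa using ht
  · rw [hdist, Equiv.apply_symm_apply]; simpa using hs
  · rw [hp₀, hiota, hiota h₁, Equiv.apply_symm_apply]; ring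
  · rw [hp₀, hiota, hiota h₁, Equiv.apply_symm_apply, ← hb] at hm
    have hm' : P (b + t) - P b + (P a - P (a + t)) = m := by linarith
    have hm0 : m = 0 := by
      rw [hm'] at hlt
      exact Int.abs_lt_one_iff.1 (by exact_mod_cast hlt)
    rw [hm0, Int.cast_zero] at hm'
    exact hne (by linarith)

/-- one can perturb two consecutive fiber maps so as to fix the
image of `w₀` (as a point of `𝕋`) while moving the image of `w₁ ≠ w₀`. -/
theorem move_one_fix_one
    {X : Type} [MetricSpace X] [CompactSpace X] [MeasurableSpace X] [BorelSpace X]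
    (g : X ≃ₜ X) (hue : UniquelyErgodic (⇑g)) (hmin : Minimal (⇑g))
    (hfac : HasFinDimNonperiodicFactor (⇑g))
    (hd : HData) (hex : hd.IsExampleI ∨ hd.IsExampleII)
    (H : X → hd.H) (hH : ContH hd H)
    (x : X) (w₀ w₁ : ℝ) (hw : ∀ m : ℤ, w₀ - w₁ ≠ (m : ℝ))
    (ε : ℝ) (hε : 0 < ε) :
    ∃ p₀ p₁ : hd.H, hd.dist p₀ (H x) < ε ∧ hd.dist p₁ (H (g x)) < ε ∧
      (∃ m : ℤ, hd.iota p₁ (hd.iota p₀ w₀) = fiberIter (⇑g) (Phi hd H) 2 x w₀ + (m : ℝ)) ∧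
      (∀ m : ℤ, hd.iota p₁ (hd.iota p₀ w₁) ≠ fiberIter (⇑g) (Phi hd H) 2 x w₁ + (m : ℝ)) := by
  have key : ∃ p₀ p₁ : hd.H, hd.dist p₀ (H x) < ε ∧ hd.dist p₁ (H (g x)) < ε ∧
      hd.iota p₁ (hd.iota p₀ w₀) = hd.iota (H (g x)) (hd.iota (H x) w₀) ∧
      ∀ m : ℤ, hd.iota p₁ (hd.iota p₀ w₁) ≠ hd.iota (H (g x)) (hd.iota (H x) w₁) + m :=
    hex.elim (fun h => exists_perturbation_of_isExampleI h _ _ hw hε)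
      (fun h => exists_perturbation_of_isExampleII h _ _ hw hε)
  obtain ⟨p₀, p₁, h₀, h₁, hfix, hmove⟩ := key
  exact ⟨p₀, p₁, h₀, h₁, ⟨0, by rw [Int.cast_zero, add_zero]; exact hfix⟩, hmove⟩

end ForcedCircle
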